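/- Let a, b, c ≥ 1 be integers and let x ∈ ℂ with x³ ≠ 1. Then for every integer n ≥ 0, (x² + x + 1)·BJ(n) = x^(n+1)·Θ - Z(n) in H. -/

import Mathlib

noncomputable section

/-- The bihyperbolic numbers over `ℂ`: the group algebra of the Klein four-group
`(ZMod 2 × ZMod 2, +)` over `ℂ`.  Its `ℂ`-basis is `1, j1, j2, j3` with
`j1² = j2² = j3² = 1`, `j1*j2 = j3`, `j1*j3 = j2`, `j2*j3 = j1`. -/
abbrev H : Type := AddMonoidAlgebra ℂ (ZMod 2 × ZMod 2)

def j1 : H := AddMonoidAlgebra.single (1, 0) 1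
def j2 : H := AddMonoidAlgebra.single (0, 1) 1
def j3 : H := AddMonoidAlgebra.single (1, 1) 1

/-- The third-order Jacobsthal polynomial sequence (evaluated at `x : ℂ`). -/
def J (x : ℂ) : ℕ → ℂ
  | 0 => 0
  | 1 => 1
  | 2 => x - 1
  | n + 3 => (x - 1) * J x (n + 2) + (x - 1) * J x (n + 1) + x * J x n

/-- The generalized bihyperbolic third-order Jacobsthal polynomial
`BJ_n^{(a,b,c)}(x) = J_n(x) + J_{n+a}(x) j1 + J_{n+b}(x) j2 + J_{n+c}(x) j3`. -/
def BJ (x : ℂ) (a b c n : ℕ) : H :=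
  algebraMap ℂ H (J x n) + algebraMap ℂ H (J x (n + a)) * j1
    + algebraMap ℂ H (J x (n + b)) * j2 + algebraMap ℂ H (J x (n + c)) * j3

/-- `Θ(y) = 1 + y^a j1 + y^b j2 + y^c j3`; used for `Θ = Th x a b c`,
`Φ1 = Th ω1 a b c`, `Φ2 = Th ω2 a b c`. -/
def Th (y : ℂ) (a b c : ℕ) : H :=
  1 + algebraMap ℂ H (y ^ a) * j1 + algebraMap ℂ H (y ^ b) * j2
    + algebraMap ℂ H (y ^ c) * j3

/-- `Z_n(x) = ((ω1 x - 1) ω1^n Φ1 - (ω2 x - 1) ω2^n Φ2) / (ω1 - ω2)`. -/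
def Z (x ω1 ω2 : ℂ) (a b c n : ℕ) : H :=
  algebraMap ℂ H (ω1 - ω2)⁻¹ *
    (algebraMap ℂ H ((ω1 * x - 1) * ω1 ^ n) * Th ω1 a b c
      - algebraMap ℂ H ((ω2 * x - 1) * ω2 ^ n) * Th ω2 a b c)

/-- The Binet formula for `J`: the characteristic polynomial of the recurrence factors as
`(λ - x) * (λ ^ 2 + λ + 1)`. -/
theorem J_binet {x ω1 ω2 : ℂ} (hω1 : ω1 ^ 2 + ω1 + 1 = 0) (hω2 : ω2 ^ 2 + ω2 + 1 = 0)
    (hω : ω1 ≠ ω2) (n : ℕ) :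
    (x ^ 2 + x + 1) * J x n = x ^ (n + 1) -
      (ω1 - ω2)⁻¹ * ((ω1 * x - 1) * ω1 ^ n - (ω2 * x - 1) * ω2 ^ n) := by
  have hd : ω1 - ω2 ≠ 0 := sub_ne_zero.mpr hω
  have hinv : (ω1 - ω2)⁻¹ * (ω1 - ω2) = 1 := inv_mul_cancel₀ hd
  have hsum : ω1 + ω2 = -1 :=
    mul_left_cancel₀ hd (by linear_combination hω1 - hω2)
  induction n using J.induct with
  | case1 =>
    simp only [J]
    linear_combination x * hinv
  | case2 =>
    simp only [J]
    linear_combination (x * (ω1 + ω2) - 1) * hinv + x * hsum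
  | case3 =>
    simp only [J]
    linear_combination (ω1 - ω2)⁻¹ * (x * (ω1 - 1) - 1) * hω1
      - (ω1 - ω2)⁻¹ * (x * (ω2 - 1) - 1) * hω2 + hinv
  | case4 n ih2 ih1 ih0 =>
    simp only [J, Nat.succ_eq_add_one]
    linear_combination (x - 1) * ih2 + (x - 1) * ih1 + x * ih0
      + (ω1 - ω2)⁻¹ * (ω1 * x - 1) * ω1 ^ n * (ω1 - x) * hω1
      - (ω1 - ω2)⁻¹ * (ω2 * x - 1) * ω2 ^ n * (ω2 - x) * hω2

theorem BJ_eq_theta_sub_Z (a b c : ℕ) (ha : 1 ≤ a) (hb : 1 ≤ b) (hc : 1 ≤ c) (x : ℂ) (hx : x ^ 3 ≠ 1)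
    (ω1 ω2 : ℂ) (hω1 : ω1 ^ 2 + ω1 + 1 = 0) (hω2 : ω2 ^ 2 + ω2 + 1 = 0)
    (hω : ω1 ≠ ω2) (n : ℕ) :
    algebraMap ℂ H (x ^ 2 + x + 1) * BJ x a b c n =
      algebraMap ℂ H (x ^ (n + 1)) * Th x a b c - Z x ω1 ω2 a b c n := by
  have h (m : ℕ) := congrArg (algebraMap ℂ H) (J_binet (x := x) hω1 hω2 hω m)
  simp only [map_mul, map_sub, map_add, map_pow, map_one, pow_add] at h
  simp only [BJ, Th, Z, map_mul, map_sub, map_add, map_pow, map_one]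
  linear_combination h n + h (n + a) * j1 + h (n + b) * j2 + h (n + c) * j3
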